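/- arXiv:gr-qc/0011076 — 2 statements merged into one kernel-verified Lean document; each statement's English description precedes it below -/
import Mathlib

section
/- For nonempty finite sets (Finsets) A, B in a type with decidable equality, define the Jaccard distance d(A,B) = 1 − |A ∩ B| / |A ∪ B| (a real number). Then d is a metric on nonempty finite sets: d(A,B) = 0 if and only if A = B, d(A,B) = d(B,A), and d(A,C) ≤ d(A,B) + d(B,C) for all nonempty finite sets A, B, C. -/
theorem Finset.card_union_add_card_inter_add_card_inter_le {α : Type*} [DecidableEq α]
    (A B C : Finset α) :
    (A ∪ B ∪ C).card + (A ∩ B).card + (B ∩ C).card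
      ≤ (A ∪ B).card + (B ∪ C).card + (A ∩ C).card := by
  have h₁ := Finset.card_union_add_card_inter (A ∪ B) (B ∪ C)
  have h₂ := Finset.card_union_add_card_inter (A ∩ B) (B ∩ C)
  have h₃ : (A ∪ B ∪ C).card = (A ∪ B ∪ (B ∪ C)).card := by
    congr 1; ext x; simp only [Finset.mem_union]; tauto
  have h₄ : (A ∩ B ∪ B ∩ C).card ≤ ((A ∪ B) ∩ (B ∪ C)).card := by
    apply Finset.card_le_card
    intro x; simp only [Finset.mem_union, Finset.mem_inter]; tauto
  have h₅ : (A ∩ B ∩ (B ∩ C)).card ≤ (A ∩ C).card := by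
    apply Finset.card_le_card
    intro x; simp only [Finset.mem_inter]; tauto
  omega

theorem Finset.card_sub_div_card_le_jaccard {α : Type*} [DecidableEq α] {A B U : Finset α}
    (hA : A.Nonempty) (hU : A ∪ B ⊆ U) :
    (((A ∪ B).card : ℝ) - (A ∩ B).card) / U.card
      ≤ 1 - ((A ∩ B).card : ℝ) / ((A ∪ B).card : ℝ) := by
  have hpos : (0 : ℝ) < (A ∪ B).card := by
    exact_mod_cast (hA.mono Finset.subset_union_left).card_pos
  have hle : ((A ∩ B).card : ℝ) ≤ (A ∪ B).card := by
    exact_mod_cast Finset.card_le_card Finset.inter_subset_union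
  have hcard : ((A ∪ B).card : ℝ) ≤ U.card := by
    exact_mod_cast Finset.card_le_card hU
  rw [one_sub_div hpos.ne']
  exact div_le_div_of_nonneg_left (sub_nonneg.2 hle) hpos hcard

/-- The Jaccard distance `1 - |A ∩ B| / |A ∪ B|` is a metric on nonempty finite
sets. -/
theorem jaccard_distance_is_metric {α : Type*} [DecidableEq α] (A B C : Finset α)
    (hA : A.Nonempty) (hB : B.Nonempty) (hC : C.Nonempty) :
    (1 - ((A ∩ B).card : ℝ) / ((A ∪ B).card : ℝ) = 0 ↔ A = B) ∧
    1 - ((A ∩ B).card : ℝ) / ((A ∪ B).card : ℝ)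
      = 1 - ((B ∩ A).card : ℝ) / ((B ∪ A).card : ℝ) ∧
    1 - ((A ∩ C).card : ℝ) / ((A ∪ C).card : ℝ)
      ≤ (1 - ((A ∩ B).card : ℝ) / ((A ∪ B).card : ℝ))
        + (1 - ((B ∩ C).card : ℝ) / ((B ∪ C).card : ℝ)) := by
  have pos {X Y : Finset α} (hX : X.Nonempty) : (0 : ℝ) < (X ∪ Y).card := by
    exact_mod_cast (hX.mono Finset.subset_union_left).card_pos
  refine ⟨?_, by rw [Finset.inter_comm, Finset.union_comm], ?_⟩
  · rw [sub_eq_zero, eq_comm, div_eq_one_iff_eq (pos hA).ne', Nat.cast_inj]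
    constructor
    · intro h
      have heq := Finset.eq_of_subset_of_card_le
        (Finset.inter_subset_union (s := A) (t := B)) h.ge
      exact inf_eq_sup.1 heq
    · rintro rfl
      simp
  · have hU : (0 : ℝ) < (A ∪ B ∪ C).card := pos (hA.mono Finset.subset_union_left)
    have hAC : ((A ∪ C).card : ℝ) ≤ (A ∪ B ∪ C).card := by
      exact_mod_cast Finset.card_le_card
        (Finset.union_subset_union_left Finset.subset_union_left)
    have hcard : ((A ∪ B ∪ C).card : ℝ) + (A ∩ B).card + (B ∩ C).card
        ≤ (A ∪ B).card + (B ∪ C).card + (A ∩ C).card := by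
      exact_mod_cast Finset.card_union_add_card_inter_add_card_inter_le A B C
    calc 1 - ((A ∩ C).card : ℝ) / ((A ∪ C).card : ℝ)
        ≤ 1 - ((A ∩ C).card : ℝ) / (A ∪ B ∪ C).card :=
          sub_le_sub_left
            (div_le_div_of_nonneg_left (Nat.cast_nonneg _) (pos hA) hAC) 1
      _ ≤ (((A ∪ B).card : ℝ) - (A ∩ B).card) / (A ∪ B ∪ C).card
          + (((B ∪ C).card : ℝ) - (B ∩ C).card) / (A ∪ B ∪ C).card := by
        rw [one_sub_div hU.ne', ← add_div]
        gcongr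
        linarith
      _ ≤ _ := add_le_add
        (Finset.card_sub_div_card_le_jaccard hA Finset.subset_union_left)
        (Finset.card_sub_div_card_le_jaccard hB
          (Finset.union_subset_union_left Finset.subset_union_right))
end

section
/- Every E-space is a Menger space with triangular norm W(a,b) = max(a+b−1, 0): let (Ω, 𝒜, P) be a probability space, (M, d) a metric space, and p, q, r : Ω → M functions such that ω ↦ d(p(ω), q(ω)), ω ↦ d(q(ω), r(ω)) and ω ↦ d(p(ω), r(ω)) are measurable. Define F_{pq}(x) = P({ω : d(p(ω), q(ω)) < x}), and similarly F_{qr} and F_{pr}. Then for all real numbers x, y: F_{pr}(x + y) ≥ max(F_{pq}(x) + F_{qr}(y) − 1, 0). -/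
open MeasureTheory

/-- Every E-space is a Menger space with triangular norm
`W(a,b) = max (a + b - 1) 0`: for functions `p q r` from a probability space into
a metric space, `F_{pr}(x+y) ≥ max (F_{pq}(x) + F_{qr}(y) - 1) 0`. -/
theorem Espace_is_Menger {Ω : Type*} [MeasurableSpace Ω] (P : Measure Ω)
    [IsProbabilityMeasure P] {M : Type*} [MetricSpace M] (p q r : Ω → M)
    (hpq : Measurable fun ω => dist (p ω) (q ω))
    (hqr : Measurable fun ω => dist (q ω) (r ω))
    (hpr : Measurable fun ω => dist (p ω) (r ω))
    (x y : ℝ) :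
    (P {ω | dist (p ω) (r ω) < x + y}).toReal ≥
      max ((P {ω | dist (p ω) (q ω) < x}).toReal
        + (P {ω | dist (q ω) (r ω) < y}).toReal - 1) 0 := by
  refine max_le ?_ ENNReal.toReal_nonneg
  set A := {ω | dist (p ω) (q ω) < x}
  set B := {ω | dist (q ω) (r ω) < y}
  have hB : MeasurableSet B := measurableSet_lt hqr measurable_const
  have hsub : A ∩ B ⊆ {ω | dist (p ω) (r ω) < x + y} := fun ω ⟨hA, hB⟩ =>
    (dist_triangle _ (q ω) _).trans_lt (add_lt_add hA hB)
  have hadd : P.real (A ∪ B) + P.real (A ∩ B) = P.real A + P.real B :=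
    measureReal_union_add_inter hB
  have hone : P.real (A ∪ B) ≤ 1 := measureReal_le_one
  have hmono := measureReal_mono (μ := P) hsub
  simp only [Measure.real] at hadd hone hmono
  linarith
end
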